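/- (Lemma 4.) Let Λ be a unital qubit channel (∑ᵢ AᵢAᵢ† = 1). Then the supremum over all unit vectors ψ ∈ ℂ²⊗ℂ² of the negativity N((id⊗Λ)(|ψ⟩⟨ψ|)) equals N(ρ_{Φ⁺,Λ}); i.e., among all pure input states, the maximally entangled input |Φ⁺⟩ maximizes the output negativity. -/

import Mathlib

open Matrix
open scoped Kronecker

noncomputable section

/-- 2×2 complex matrices (single-qubit operators). -/
abbrev QMat := Matrix (Fin 2) (Fin 2) ℂ

/-- 4×4 complex matrices indexed by `Fin 2 × Fin 2` (two-qubit operators). -/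
abbrev TMat := Matrix (Fin 2 × Fin 2) (Fin 2 × Fin 2) ℂ

/-- Vectors in ℂ²⊗ℂ², indexed by `Fin 2 × Fin 2`. -/
abbrev TVec := (Fin 2 × Fin 2) → ℂ

/-- Outer product |ψ⟩⟨φ|. -/
def outer (ψ φ : TVec) : TMat := Matrix.vecMulVec ψ (star φ)

/-- The maximally entangled vector |Φ⁺⟩ = (|00⟩+|11⟩)/√2. -/
def phiPlus : TVec := fun p => if p.1 = p.2 then ((Real.sqrt 2 : ℂ))⁻¹ else 0

/-- Action of id ⊗ Λ on two-qubit matrices, for a channel Λ with Kraus family `A`. -/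
def channelOut {ι : Type*} [Fintype ι] (A : ι → QMat) (M : TMat) : TMat :=
  ∑ i, ((1 : QMat) ⊗ₖ A i) * M * ((1 : QMat) ⊗ₖ A i)ᴴ

/-- The Choi matrix ρ_{Φ⁺,Λ} = (id⊗Λ)(|Φ⁺⟩⟨Φ⁺|). -/
def choi {ι : Type*} [Fintype ι] (A : ι → QMat) : TMat :=
  channelOut A (outer phiPlus phiPlus)

/-- The Choi matrix of the dual channel: ρ_{Φ⁺,Λ̂} = ∑ᵢ (1⊗Aᵢᴴ)|Φ⁺⟩⟨Φ⁺|(1⊗Aᵢ). -/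
def choiDual {ι : Type*} [Fintype ι] (A : ι → QMat) : TMat :=
  channelOut (fun i => (A i)ᴴ) (outer phiPlus phiPlus)

/-- Kraus (trace-preserving) condition ∑ᵢ Aᵢᴴ Aᵢ = 1. -/
def IsKraus {ι : Type*} [Fintype ι] (A : ι → QMat) : Prop := ∑ i, (A i)ᴴ * A i = 1

/-- Partial trace over the second factor. -/
def ptraceB (M : TMat) : QMat := Matrix.of fun i j => ∑ k, M (i, k) (j, k)

/-- Unit vector: ⟨ψ|ψ⟩ = 1. -/
def IsUnitVec (ψ : TVec) : Prop := star ψ ⬝ᵥ ψ = 1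

/-- Maximally entangled vector: the partial trace of |ψ⟩⟨ψ| over the second
factor is (1/2)·1. -/
def MaxEnt (ψ : TVec) : Prop := ptraceB (outer ψ ψ) = (1/2 : ℂ) • 1

/-- Partial transpose on the first factor: M^Γ((i,k),(j,l)) = M((j,k),(i,l)). -/
def ptransp (M : TMat) : TMat := Matrix.of fun p q => M (q.1, p.2) (p.1, q.2)

open Classical in
/-- Largest eigenvalue of a Hermitian matrix (junk value 0 otherwise). -/
def lamMax {n : Type*} [Fintype n] [DecidableEq n] (M : Matrix n n ℂ) : ℝ :=
  if h : M.IsHermitian then ⨆ i, h.eigenvalues i else 0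

open Classical in
/-- Smallest eigenvalue of a Hermitian matrix (junk value 0 otherwise). -/
def lamMin {n : Type*} [Fintype n] [DecidableEq n] (M : Matrix n n ℂ) : ℝ :=
  if h : M.IsHermitian then ⨅ i, h.eigenvalues i else 0

/-- Negativity N(ρ) = max{0, −2 λ_min(ρ^Γ)}. -/
def negativity (M : TMat) : ℝ := max 0 (-2 * lamMin (ptransp M))

/-- The swap operator V on ℂ²⊗ℂ²: V(eᵢ⊗eⱼ) = eⱼ⊗eᵢ. -/
def swapM : TMat := Matrix.of fun p q => if p.1 = q.2 ∧ p.2 = q.1 then 1 else 0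

/-- The vector √λ|00⟩ + √(1−λ)|11⟩. -/
def xvec (l : ℝ) : TVec := fun p =>
  if p = (0, 0) then (Real.sqrt l : ℂ) else if p = (1, 1) then (Real.sqrt (1 - l) : ℂ) else 0

/-- Kraus operators of the amplitude damping channel with parameter p. -/
def adKraus (p : ℝ) : Fin 2 → QMat :=
  ![!![1, 0; 0, (Real.sqrt (1 - p) : ℂ)], !![0, (Real.sqrt p : ℂ); 0, 0]]

end

open scoped ComplexConjugate

/-- The squared Euclidean norm of a vector in ℂ²⊗ℂ². -/
noncomputable def normSqT (P : TVec) : ℝ := ∑ p, Complex.normSq (P p)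

/-- The determinant of a vector in ℂ²⊗ℂ² read as a 2×2 matrix. -/
noncomputable def detT (P : TVec) : ℂ := P (0, 0) * P (1, 1) - P (0, 1) * P (1, 0)

/-- The spin flip, an antiunitary involution of ℂ²⊗ℂ². -/
noncomputable def spinFlip (P : TVec) : TVec :=
  fun p => (if p.1 = p.2 then 1 else -1) * conj (P (p.1 + 1, p.2 + 1))

/-- The off-diagonal antisymmetric part of the matrix product `B * P`. -/
noncomputable def skewPart (B : QMat) (P : TVec) : ℂ :=
  B 0 0 * P (0, 1) + B 0 1 * P (1, 1) - B 1 0 * P (0, 0) - B 1 1 * P (1, 0)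

/-- The quadratic form of the partially transposed channel output, as a function of the product
of the input vector and the test vector. -/
noncomputable def outForm {ι : Type*} [Fintype ι] (A : ι → QMat) (P : TVec) : ℝ :=
  normSqT P - ∑ i, Complex.normSq (skewPart (A i) P)

/-- The matrix product `ψᵀ * φ` of two vectors in ℂ²⊗ℂ². -/
noncomputable def contract (ψ φ : TVec) : TVec := fun p => ∑ j, ψ (j, p.1) * φ (j, p.2)

theorem normSqT_nonneg (P : TVec) : 0 ≤ normSqT P :=
  Finset.sum_nonneg fun _ _ => Complex.normSq_nonneg _

theorem star_dotProduct_self (x : TVec) : star x ⬝ᵥ x = (normSqT x : ℂ) := by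
  simp [dotProduct, normSqT, Complex.normSq_eq_conj_mul_self]

theorem detT_contract (ψ φ : TVec) : detT (contract ψ φ) = detT ψ * detT φ := by
  simp only [detT, contract, Fin.sum_univ_two]
  ring

theorem two_mul_norm_detT_le (P : TVec) : 2 * ‖detT P‖ ≤ normSqT P := by
  have h : ‖detT P‖ ≤ ‖P (0, 0)‖ * ‖P (1, 1)‖ + ‖P (0, 1)‖ * ‖P (1, 0)‖ := by
    simpa [detT] using norm_sub_le (P (0, 0) * P (1, 1)) (P (0, 1) * P (1, 0))
  simp only [normSqT, Fintype.sum_prod_type, Fin.sum_univ_two, Complex.normSq_eq_norm_sq]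
  nlinarith [sq_nonneg (‖P (0, 0)‖ - ‖P (1, 1)‖), sq_nonneg (‖P (0, 1)‖ - ‖P (1, 0)‖)]

theorem normSqT_smul (c : ℂ) (P : TVec) : normSqT (c • P) = Complex.normSq c * normSqT P := by
  simp [normSqT, Finset.mul_sum]

theorem detT_smul (c : ℂ) (P : TVec) : detT (c • P) = c ^ 2 * detT P := by
  simp only [detT, Pi.smul_apply, smul_eq_mul]
  ring

theorem skewPart_smul (B : QMat) (c : ℂ) (P : TVec) :
    skewPart B (c • P) = c * skewPart B P := by
  simp only [skewPart, Pi.smul_apply, smul_eq_mul]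
  ring

theorem outForm_smul {ι : Type*} [Fintype ι] (A : ι → QMat) (c : ℂ) (P : TVec) :
    outForm A (c • P) = Complex.normSq c * outForm A P := by
  simp only [outForm, normSqT_smul, skewPart_smul, Complex.normSq_mul, ← Finset.mul_sum]
  ring

theorem normSqT_spinFlip (P : TVec) : normSqT (spinFlip P) = normSqT P := by
  simp [normSqT, spinFlip, Fintype.sum_prod_type]
  ring

theorem normSqT_add_add_normSqT_sub (P Q : TVec) :
    normSqT (P + Q) + normSqT (P - Q) = 2 * (normSqT P + normSqT Q) := by
  simp only [normSqT, Pi.add_apply, Pi.sub_apply, Complex.normSq_add, Complex.normSq_sub,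
    ← Finset.sum_add_distrib, Finset.mul_sum]
  exact Finset.sum_congr rfl fun _ _ => by ring

theorem outForm_add_add_outForm_sub {ι : Type*} [Fintype ι] (A : ι → QMat) (P Q : TVec) :
    outForm A (P + Q) + outForm A (P - Q) = 2 * (outForm A P + outForm A Q) := by
  have hadd (B : QMat) : skewPart B (P + Q) = skewPart B P + skewPart B Q := by
    simp only [skewPart, Pi.add_apply]; ring
  have hsub (B : QMat) : skewPart B (P - Q) = skewPart B P - skewPart B Q := by
    simp only [skewPart, Pi.sub_apply]; ring
  have h : (∑ i, Complex.normSq (skewPart (A i) (P + Q))) +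
      ∑ i, Complex.normSq (skewPart (A i) (P - Q)) =
      2 * ((∑ i, Complex.normSq (skewPart (A i) P)) +
        ∑ i, Complex.normSq (skewPart (A i) Q)) := by
    simp only [hadd, hsub, Complex.normSq_add, Complex.normSq_sub, ← Finset.sum_add_distrib,
      Finset.mul_sum]
    exact Finset.sum_congr rfl fun _ _ => by ring
  simp only [outForm]
  linarith [normSqT_add_add_normSqT_sub P Q]

/-- The trace of `Pᴴ * L * P`. -/
noncomputable def gramForm (P : TVec) (L : QMat) : ℂ :=
  ∑ i, ∑ j, L i j * ∑ k, P (j, k) * conj (P (i, k))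

theorem gramForm_sum {ι : Type*} [Fintype ι] (P : TVec) (L : ι → QMat) :
    ∑ i, gramForm P (L i) = gramForm P (∑ i, L i) := by
  simp only [gramForm, Matrix.sum_apply, Finset.sum_add_distrib, ← Finset.sum_mul,
    Fin.sum_univ_two]

theorem gramForm_one (P : TVec) : gramForm P 1 = normSqT P := by
  simp [gramForm, normSqT, Complex.normSq_eq_conj_mul_self, Fintype.sum_prod_type]
  ring

/-- The linear form in `Bᴴ * B` and `B * Bᴴ` measuring the failure of spin-flip invariance. -/
noncomputable def flipDefect (P : TVec) (L R : QMat) : ℂ :=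
  (L 0 0 + L 1 1) * normSqT P
    - gramForm P L
    - (R 1 1 * ∑ k, P (k, 0) * conj (P (k, 0)) + R 0 0 * ∑ k, P (k, 1) * conj (P (k, 1))
      - R 1 0 * ∑ k, P (k, 0) * conj (P (k, 1)) - R 0 1 * ∑ k, P (k, 1) * conj (P (k, 0)))

theorem flipDefect_sum {ι : Type*} [Fintype ι] (P : TVec) (L R : ι → QMat) :
    ∑ i, flipDefect P (L i) (R i) = flipDefect P (∑ i, L i) (∑ i, R i) := by
  simp only [flipDefect, ← gramForm_sum, Matrix.sum_apply, Finset.sum_sub_distrib, Finset.sum_add_distrib,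
    ← Finset.sum_mul, Fin.sum_univ_two]

theorem normSq_skewPart_spinFlip (B : QMat) (P : TVec) :
    (Complex.normSq (skewPart B (spinFlip P)) : ℂ) =
      Complex.normSq (skewPart B P) + flipDefect P (Bᴴ * B) (B * Bᴴ) := by
  simp [flipDefect, gramForm, normSqT, Complex.normSq_eq_conj_mul_self, skewPart, spinFlip,
    Fintype.sum_prod_type,
    Matrix.mul_apply]
  ring

theorem outForm_spinFlip {ι : Type*} [Fintype ι] {A : ι → QMat} (hA : IsKraus A)
    (hUnital : ∑ i, A i * (A i)ᴴ = 1) (P : TVec) : outForm A (spinFlip P) = outForm A P := by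
  have hsum : ∑ i, flipDefect P ((A i)ᴴ * A i) (A i * (A i)ᴴ) = flipDefect P 1 1 := by
    rw [flipDefect_sum, hUnital, show ∑ i, (A i)ᴴ * A i = 1 from hA]
  have h0 : flipDefect P 1 1 = 0 := by
    simp [flipDefect, gramForm, normSqT, Complex.normSq_eq_conj_mul_self, Fintype.sum_prod_type]
    ring
  have h : (∑ i, Complex.normSq (skewPart (A i) (spinFlip P)) : ℂ) =
      ∑ i, (Complex.normSq (skewPart (A i) P) : ℂ) := by
    simp only [normSq_skewPart_spinFlip, Finset.sum_add_distrib, hsum, h0, add_zero]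
  rw [outForm, outForm, normSqT_spinFlip]
  exact_mod_cast congrArg (fun z => (normSqT P : ℂ) - z) h

theorem norm_inner_sq_add_norm_inner_sq_le {E : Type*} [NormedAddCommGroup E]
    [InnerProductSpace ℂ E] {u v : E} (w : E) (h : inner ℂ u v = 0) :
    ‖inner ℂ w u‖ ^ 2 * ‖v‖ ^ 2 + ‖inner ℂ w v‖ ^ 2 * ‖u‖ ^ 2 ≤ ‖w‖ ^ 2 * (‖u‖ ^ 2 * ‖v‖ ^ 2) := by
  rcases eq_or_ne u 0 with rfl | hu
  · simp
  rcases eq_or_ne v 0 with rfl | hv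
  · simp
  have hu' := norm_pos_iff.2 hu
  have hv' := norm_pos_iff.2 hv
  have hon : Orthonormal ℂ ![((‖u‖⁻¹ : ℝ) : ℂ) • u, ((‖v‖⁻¹ : ℝ) : ℂ) • v] := by
    have h' : inner ℂ v u = 0 := inner_eq_zero_symm.1 h
    constructor
    · intro i
      fin_cases i <;> simp [norm_smul, hu'.ne', hv'.ne']
    · intro i j hij
      fin_cases i <;> fin_cases j <;> simp_all [inner_smul_left, inner_smul_right]
  rw [norm_inner_symm w u, norm_inner_symm w v]
  have hb := hon.sum_inner_products_le (s := Finset.univ) (x := w)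
  simp only [Fin.sum_univ_two, Matrix.cons_val_zero, Matrix.cons_val_one, inner_smul_left,
    norm_mul, Complex.conj_ofReal, Complex.norm_real, norm_inv, norm_norm, mul_pow, inv_pow] at hb
  have hmul := mul_le_mul_of_nonneg_right hb (by positivity : 0 ≤ ‖u‖ ^ 2 * ‖v‖ ^ 2)
  refine le_trans (le_of_eq ?_) hmul
  field_simp

theorem normSq_skewPart_le {U V : TVec} (h : star U ⬝ᵥ V = 0) (B : QMat) :
    Complex.normSq (skewPart B U) * normSqT V + Complex.normSq (skewPart B V) * normSqT U ≤
      (Bᴴ * B).trace.re * (normSqT U * normSqT V) := by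
  have hn (P : TVec) : ‖WithLp.toLp 2 P‖ ^ 2 = normSqT P := by
    simp [EuclideanSpace.norm_sq_eq, normSqT, Complex.normSq_eq_norm_sq]
  let w : TVec := fun p => (if p.2 = 0 then -1 else 1) * conj (B (p.2 + 1) p.1)
  have hw (P : TVec) : inner ℂ (WithLp.toLp 2 w) (WithLp.toLp 2 P) = skewPart B P := by
    simp [EuclideanSpace.inner_toLp_toLp, dotProduct, w, skewPart, Fintype.sum_prod_type]
    ring
  have hw' : normSqT w = (Bᴴ * B).trace.re := by
    simp [normSqT, w, Fintype.sum_prod_type, Matrix.trace, Matrix.mul_apply, Complex.normSq_apply]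
    ring
  have := norm_inner_sq_add_norm_inner_sq_le (WithLp.toLp 2 w)
    (u := WithLp.toLp 2 U) (v := WithLp.toLp 2 V)
    (by rw [EuclideanSpace.inner_toLp_toLp, dotProduct_comm, h])
  simpa only [hw, hn, hw', ← Complex.normSq_eq_norm_sq] using this

theorem outForm_orthogonal_nonneg {ι : Type*} [Fintype ι] {A : ι → QMat} (hA : IsKraus A)
    {U V : TVec} (h : star U ⬝ᵥ V = 0) :
    0 ≤ outForm A U * normSqT V + outForm A V * normSqT U := by
  have hs := Finset.sum_le_sum fun i (_ : i ∈ Finset.univ) => normSq_skewPart_le h (A i)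
  have ht : ∑ i, ((A i)ᴴ * A i).trace.re = 2 := by
    rw [← Complex.re_sum, ← Matrix.trace_sum, show ∑ i, (A i)ᴴ * A i = 1 from hA]
    simp
  rw [Finset.sum_add_distrib, ← Finset.sum_mul, ← Finset.sum_mul, ← Finset.sum_mul, ht] at hs
  simp only [outForm]
  linarith

theorem star_add_spinFlip_dotProduct_sub (P : TVec) (h : (detT P).im = 0) :
    star (P + spinFlip P) ⬝ᵥ (P - spinFlip P) = 0 := by
  have h' : conj (detT P) = detT P := Complex.conj_eq_iff_im.2 h
  simp only [detT, map_sub, map_mul] at h'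
  simp [dotProduct, spinFlip, Fintype.sum_prod_type]
  linear_combination -2 * h'

theorem normSqT_add_spinFlip_sub (P : TVec) :
    normSqT (P + spinFlip P) - normSqT (P - spinFlip P) = 8 * (detT P).re := by
  simp [normSqT, spinFlip, Fintype.sum_prod_type, Complex.normSq_apply, detT]
  ring

theorem exists_normSq_eq_one_sq_mul_eq_norm (d : ℂ) :
    ∃ c : ℂ, Complex.normSq c = 1 ∧ c ^ 2 * d = ‖d‖ := by
  refine ⟨Complex.exp ((-(d.arg / 2) : ℝ) * Complex.I), ?_, ?_⟩
  · rw [Complex.normSq_eq_norm_sq, Complex.norm_exp_ofReal_mul_I, one_pow]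
  · conv_lhs => arg 2; rw [← Complex.norm_mul_exp_arg_mul_I d]
    rw [← Complex.exp_nat_mul, mul_left_comm, ← Complex.exp_add]
    rw [show (2 : ℕ) * (((-(d.arg / 2) : ℝ) : ℂ) * Complex.I) + d.arg * Complex.I = 0 by
      push_cast; ring, Complex.exp_zero, mul_one]

theorem le_outForm {ι : Type*} [Fintype ι] {A : ι → QMat} (hA : IsKraus A)
    (hUnital : ∑ i, A i * (A i)ᴴ = 1) {m : ℝ} (hm : ∀ P, m * normSqT P ≤ outForm A P)
    (P : TVec) : 2 * m * ‖detT P‖ ≤ outForm A P := by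
  obtain ⟨c, hc, hd⟩ := exists_normSq_eq_one_sq_mul_eq_norm (detT P)
  have hdet := detT_smul c P
  have hform := outForm_smul A c P
  rw [hd] at hdet
  rw [hc, one_mul] at hform
  set Q := c • P
  have hperp := outForm_orthogonal_nonneg hA
    (star_add_spinFlip_dotProduct_sub Q (by rw [hdet, Complex.ofReal_im]))
  have hdiff := normSqT_add_spinFlip_sub Q
  rw [hdet, Complex.ofReal_re] at hdiff
  have hpar := outForm_add_add_outForm_sub A Q (spinFlip Q)
  rw [outForm_spinFlip hA hUnital, hform] at hpar
  have hU := hm (Q + spinFlip Q)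
  have hV := hm (Q - spinFlip Q)
  have hU0 := normSqT_nonneg (Q + spinFlip Q)
  have hV0 := normSqT_nonneg (Q - spinFlip Q)
  have hd0 := norm_nonneg (detT P)
  generalize normSqT (Q + spinFlip Q) = nU at *
  generalize normSqT (Q - spinFlip Q) = nV at *
  generalize outForm A (Q + spinFlip Q) = fU at *
  generalize outForm A (Q - spinFlip Q) = fV at *
  rcases hU0.eq_or_lt with h0 | hpos
  · have h1 : nV = 0 := by linarith
    have h2 : ‖detT P‖ = 0 := by linarith
    subst h1 h0
    rw [h2]
    linarith
  · have h1 : nU * (m * (nU - nV)) ≤ nU * (fU + fV) := by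
      nlinarith [mul_le_mul_of_nonneg_right hU (by linarith : 0 ≤ nU - nV)]
    have h2 := le_of_mul_le_mul_left h1 hpos
    rw [hdiff] at h2
    linarith

theorem star_dotProduct_ptransp_channelOut {ι : Type*} [Fintype ι] {A : ι → QMat}
    (hA : IsKraus A) (ψ φ : TVec) :
    star φ ⬝ᵥ (ptransp (channelOut A (outer ψ ψ)) *ᵥ φ) = (outForm A (contract ψ φ) : ℂ) := by
  have hterm (B : QMat) :
      star φ ⬝ᵥ (ptransp (((1 : QMat) ⊗ₖ B) * outer ψ ψ * ((1 : QMat) ⊗ₖ B)ᴴ) *ᵥ φ) =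
        gramForm (contract ψ φ) (Bᴴ * B) - Complex.normSq (skewPart B (contract ψ φ)) := by
    simp [dotProduct, Matrix.mulVec, ptransp, outer, vecMulVec_apply, Matrix.mul_apply,
      Fintype.sum_prod_type, Complex.normSq_eq_conj_mul_self, skewPart, contract, gramForm,
      Matrix.one_apply]
    ring
  have hsum : ptransp (channelOut A (outer ψ ψ)) =
      ∑ i, ptransp (((1 : QMat) ⊗ₖ A i) * outer ψ ψ * ((1 : QMat) ⊗ₖ A i)ᴴ) := by
    ext p q
    simp [ptransp, channelOut, Matrix.sum_apply]
  rw [hsum, Matrix.sum_mulVec, dotProduct_sum]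
  simp only [hterm, Finset.sum_sub_distrib, gramForm_sum]
  rw [show ∑ i, (A i)ᴴ * A i = 1 from hA, gramForm_one, outForm]
  push_cast
  rfl

theorem isHermitian_ptransp_channelOut {ι : Type*} [Fintype ι] (A : ι → QMat) (ψ : TVec) :
    (ptransp (channelOut A (outer ψ ψ))).IsHermitian := by
  have h : (channelOut A (outer ψ ψ)).IsHermitian := by
    have ho : (outer ψ ψ)ᴴ = outer ψ ψ := by
      ext p q; simp [outer, vecMulVec_apply, mul_comm]
    simp [Matrix.IsHermitian, channelOut, Matrix.conjTranspose_sum, Matrix.conjTranspose_mul,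
      ho, Matrix.mul_assoc]
  ext p q
  exact h.apply (q.1, p.2) (p.1, q.2)

open scoped ComplexOrder in
theorem lamMin_mul_le {M : TMat} (hM : M.IsHermitian) (x : TVec) :
    lamMin M * normSqT x ≤ (star x ⬝ᵥ (M *ᵥ x)).re := by
  have hl : lamMin M = ⨅ i, hM.eigenvalues i := by rw [lamMin, dif_pos hM]
  have hle (i) : lamMin M ≤ hM.eigenvalues i := hl ▸ ciInf_le (Finite.bddBelow_range _) i
  have hpsd : (M - (lamMin M : ℂ) • 1).PosSemidef := by
    set U : TMat := (hM.eigenvectorUnitary : TMat)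
    have hU : U * Uᴴ = 1 := Unitary.coe_mul_star_self hM.eigenvectorUnitary
    have hMU : M = U * diagonal (fun i => (hM.eigenvalues i : ℂ)) * Uᴴ := hM.spectral_theorem
    have hd : (diagonal fun i => ((hM.eigenvalues i - lamMin M : ℝ) : ℂ)).PosSemidef :=
      PosSemidef.diagonal fun i => by
        simpa using! Complex.zero_le_real.2 (sub_nonneg.2 (hle i))
    have hdiag : (diagonal fun i => ((hM.eigenvalues i - lamMin M : ℝ) : ℂ)) =
        diagonal (fun i => (hM.eigenvalues i : ℂ)) - (lamMin M : ℂ) • (1 : TMat) := by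
      rw [smul_one_eq_diagonal, diagonal_sub]
      simp
    have h := hd.mul_mul_conjTranspose_same U
    rwa [hdiag, Matrix.mul_sub, Matrix.sub_mul, ← hMU, Matrix.mul_smul, Matrix.mul_one,
      Matrix.smul_mul, hU] at h
  have h := hpsd.re_dotProduct_nonneg x
  rw [Matrix.sub_mulVec, Matrix.smul_mulVec, Matrix.one_mulVec, dotProduct_sub, dotProduct_smul,
    star_dotProduct_self] at h
  simpa using h

theorem le_lamMin {M : TMat} (hM : M.IsHermitian) {c : ℝ}
    (h : ∀ x : TVec, c * normSqT x ≤ (star x ⬝ᵥ (M *ᵥ x)).re) : c ≤ lamMin M := by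
  rw [lamMin, dif_pos hM]
  refine le_ciInf fun i => ?_
  have hi := h (hM.eigenvectorBasis i)
  have h1 : normSqT (hM.eigenvectorBasis i) = 1 := by
    have := EuclideanSpace.norm_sq_eq (hM.eigenvectorBasis i)
    rw [hM.eigenvectorBasis.orthonormal.1 i] at this
    simp [normSqT, Complex.normSq_eq_norm_sq, ← this]
  rw [h1, mul_one] at hi
  rw [hM.eigenvalues_eq i]
  exact hi

theorem isUnitVec_phiPlus : IsUnitVec phiPlus := by
  rw [IsUnitVec, star_dotProduct_self]
  simp only [normSqT, phiPlus, Fintype.sum_prod_type, Fin.sum_univ_two]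
  norm_num [Complex.normSq_ofReal]

theorem contract_phiPlus (φ : TVec) : contract phiPlus φ = ((Real.sqrt 2 : ℂ))⁻¹ • φ := by
  ext p
  simp [contract, phiPlus]

/-- Lemma 4: for a unital qubit channel, the maximal output negativity over
pure input states equals the negativity of the Choi state, attained at |Φ⁺⟩. -/
theorem stmt16 {ι : Type*} [Fintype ι] (A : ι → QMat) (hA : IsKraus A)
    (hUnital : ∑ i, A i * (A i)ᴴ = 1) :
    IsGreatest {r : ℝ | ∃ ψ : TVec, IsUnitVec ψ ∧
        r = negativity (channelOut A (outer ψ ψ))}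
      (negativity (choi A)) := by
  refine ⟨⟨phiPlus, isUnitVec_phiPlus, rfl⟩, ?_⟩
  rintro _ ⟨ψ, hψ, rfl⟩
  set m := lamMin (ptransp (choi A)) with hm
  have hψ1 : normSqT ψ = 1 := by
    rw [IsUnitVec, star_dotProduct_self] at hψ
    exact_mod_cast hψ
  have hchoi (P : TVec) : 2 * m * normSqT P ≤ outForm A P := by
    have h := lamMin_mul_le (isHermitian_ptransp_channelOut A phiPlus) P
    rw [star_dotProduct_ptransp_channelOut hA, contract_phiPlus, outForm_smul,
      Complex.ofReal_re] at h
    change m * normSqT P ≤ _ at h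
    rw [map_inv₀, Complex.normSq_ofReal, Real.mul_self_sqrt zero_le_two] at h
    linarith
  have hmin : min m 0 ≤ lamMin (ptransp (channelOut A (outer ψ ψ))) := by
    refine le_lamMin (isHermitian_ptransp_channelOut A ψ) fun φ => ?_
    rw [star_dotProduct_ptransp_channelOut hA, Complex.ofReal_re]
    rcases le_total 0 m with h0 | h0
    · rw [min_eq_right h0, zero_mul]
      exact (mul_nonneg (by linarith) (normSqT_nonneg _)).trans (hchoi _)
    · rw [min_eq_left h0]
      refine le_trans ?_ (le_outForm hA hUnital hchoi _)
      have h1 := two_mul_norm_detT_le ψ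
      have h2 := two_mul_norm_detT_le φ
      rw [hψ1] at h1
      rw [detT_contract, norm_mul]
      have h3 : (2 * ‖detT ψ‖) * (2 * ‖detT φ‖) ≤ 1 * normSqT φ :=
        mul_le_mul h1 h2 (by positivity) zero_le_one
      nlinarith
  rw [negativity, negativity, ← hm]
  refine max_le (le_max_left _ _) ?_
  rcases min_le_iff.1 hmin with h | h
  · exact le_max_of_le_right (by linarith)
  · exact le_max_of_le_left (by linarith)
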